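/- Let n ≥ 1 and let k be an integer with 1 ≤ k ≤ n. If φ : B → ℤ satisfies S(φ)(1) = 2n+1 and S(φ)(i) = 0 for every i with 2 ≤ i ≤ k (with no condition on the coordinates of index greater than k), then Σ_{v∈B} |φ(v)| ≥ n+k. -/

import Mathlib

/-- The `j`-th standard basis vector of `ℤⁿ` (indices are 1-based),
with the convention that it is the zero vector when `j > n` (or `j = 0`). -/
def stdVec (n : ℕ) (j : ℕ) : Fin n → ℤ := fun i => if (i : ℕ) + 1 = j then 1 else 0

/-- The finite set `B ⊆ ℤⁿ` consisting of the vectors `2e_i` (`1 ≤ i ≤ n`),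
`e_i + e_{i+1}` (`1 ≤ i ≤ n`), `e_i − e_{i+1}` (`1 ≤ i ≤ n`), `2e_1 − 2e_2`,
and `e_i − 2e_{i+1} + e_{i+2}` (`1 ≤ i ≤ n`). -/
def Bset (n : ℕ) : Finset (Fin n → ℤ) :=
  ((Finset.Icc 1 n).image fun i => 2 • stdVec n i) ∪
  ((Finset.Icc 1 n).image fun i => stdVec n i + stdVec n (i + 1)) ∪
  ((Finset.Icc 1 n).image fun i => stdVec n i - stdVec n (i + 1)) ∪
  {2 • stdVec n 1 - 2 • stdVec n 2} ∪
  ((Finset.Icc 1 n).image fun i => stdVec n i - 2 • stdVec n (i + 1) + stdVec n (i + 2))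

/-- The `i`-th coordinate (1-based) of a vector `w ∈ ℤⁿ`. -/
def coord {n : ℕ} (w : Fin n → ℤ) (i : ℕ) : ℤ :=
  if h : i - 1 < n then w ⟨i - 1, h⟩ else 0

/-- `S(φ) = Σ_{v ∈ B} φ(v)·v ∈ ℤⁿ`. -/
def Ssum {n : ℕ} (φ : (Fin n → ℤ) → ℤ) : Fin n → ℤ := ∑ v ∈ Bset n, φ v • v

/-- `|φ| = Σ_{v ∈ B} |φ(v)|`. -/
def absSum {n : ℕ} (φ : (Fin n → ℤ) → ℤ) : ℤ := ∑ v ∈ Bset n, |φ v|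

/-- Linear combinations over the image of a finite set lift to combinations over the set itself,
with the same total absolute weight. -/
theorem exists_lift_sum_image {ι M : Type*} [DecidableEq ι] [DecidableEq M] [AddCommGroup M]
    (s : Finset ι) (f : ι → M) (φ : M → ℤ) :
    ∃ a : ι → ℤ, ∑ i ∈ s, a i • f i = ∑ v ∈ s.image f, φ v • v ∧
      ∑ i ∈ s, |a i| = ∑ v ∈ s.image f, |φ v| := by
  obtain ⟨t, hts, hinj, himg⟩ :=
    Finset.exists_subset_injOn_image_eq_of_surjOn s (s.image f) (f := f) (by simp [Set.surjOn_image])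
  refine ⟨fun i => if i ∈ t then φ (f i) else 0, ?_, ?_⟩
  · rw [← himg, Finset.sum_image hinj]
    simp only [ite_smul, zero_smul, Finset.sum_ite_mem, Finset.inter_eq_right.mpr hts]
  · rw [← himg, Finset.sum_image hinj]
    simp only [apply_ite abs, abs_zero, Finset.sum_ite_mem, Finset.inter_eq_right.mpr hts]

/-- The members of `Bset n`, listed with repetitions. -/
def genVec (n : ℕ) : (ℕ × Fin 4) ⊕ Unit → Fin n → ℤ
  | .inl (i, 0) => 2 • stdVec n i
  | .inl (i, 1) => stdVec n i + stdVec n (i + 1)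
  | .inl (i, 2) => stdVec n i - stdVec n (i + 1)
  | .inl (i, 3) => stdVec n i - 2 • stdVec n (i + 1) + stdVec n (i + 2)
  | .inr () => 2 • stdVec n 1 - 2 • stdVec n 2

/-- The indices of the vectors listed by `genVec n`. -/
def genIdx (n : ℕ) : Finset ((ℕ × Fin 4) ⊕ Unit) :=
  (Finset.Icc 1 n ×ˢ Finset.univ).disjSum Finset.univ

theorem image_genVec (n : ℕ) : (genIdx n).image (genVec n) = Bset n := by
  ext v
  simp only [genIdx, Bset, Finset.mem_image, Finset.mem_union, Finset.mem_singleton, Sum.exists,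
    Prod.exists, Fin.exists_fin_succ, Finset.inl_mem_disjSum, Finset.inr_mem_disjSum,
    Finset.mem_product, Finset.mem_univ, and_true, true_and]
  simp [genVec, exists_or, eq_comm (a := v), or_assoc]
  grind

theorem sum_genIdx {M : Type*} [AddCommMonoid M] (n : ℕ) (g : (ℕ × Fin 4) ⊕ Unit → M) :
    ∑ t ∈ genIdx n, g t = ∑ i ∈ Finset.Icc 1 n, (g (.inl (i, 0)) + g (.inl (i, 1)) +
      g (.inl (i, 2)) + g (.inl (i, 3))) + g (.inr ()) := by
  simp [genIdx, Finset.sum_disjSum, Finset.sum_product, Fin.sum_univ_four]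

theorem coord_stdVec {n j : ℕ} (hj : 1 ≤ j) (hjn : j ≤ n) (i : ℕ) :
    coord (stdVec n i) j = if i = j then 1 else 0 := by
  have h : j - 1 < n := by omega
  simp only [coord, h, stdVec, dite_true]
  congr 1
  apply propext
  omega

theorem coord_add {n : ℕ} (v w : Fin n → ℤ) (j : ℕ) : coord (v + w) j = coord v j + coord w j := by
  unfold coord; split_ifs <;> simp

theorem coord_sub {n : ℕ} (v w : Fin n → ℤ) (j : ℕ) : coord (v - w) j = coord v j - coord w j := by
  unfold coord; split_ifs <;> simp

theorem coord_zsmul {n : ℕ} (a : ℤ) (v : Fin n → ℤ) (j : ℕ) : coord (a • v) j = a * coord v j := by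
  unfold coord; split_ifs <;> simp

theorem coord_nsmul {n : ℕ} (a : ℕ) (v : Fin n → ℤ) (j : ℕ) : coord (a • v) j = a * coord v j := by
  unfold coord; split_ifs <;> simp

theorem coord_sum {n : ℕ} {ι : Type*} (s : Finset ι) (f : ι → Fin n → ℤ) (j : ℕ) :
    coord (∑ i ∈ s, f i) j = ∑ i ∈ s, coord (f i) j := by
  unfold coord; split_ifs <;> simp

/-- Coordinates of a linear combination of the listed vectors; a term whose index
drops to zero is absent. -/
theorem coord_sum_genVec {n j : ℕ} (hj : 1 ≤ j) (hjn : j ≤ n) (a : (ℕ × Fin 4) ⊕ Unit → ℤ) :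
    coord (∑ t ∈ genIdx n, a t • genVec n t) j =
      2 * a (.inl (j, 0)) + a (.inl (j, 1)) + a (.inl (j, 2)) + a (.inl (j, 3)) +
      (if 2 ≤ j then a (.inl (j - 1, 1)) - a (.inl (j - 1, 2)) - 2 * a (.inl (j - 1, 3)) else 0) +
      (if 3 ≤ j then a (.inl (j - 2, 3)) else 0) +
      (if j = 1 then 2 * a (.inr ()) else 0) - (if j = 2 then 2 * a (.inr ()) else 0) := by
  have key (b : ℕ → ℤ) (l : ℕ) :
      ∑ i ∈ Finset.Icc 1 n, (if i + l = j then b i else 0) = if l + 1 ≤ j then b (j - l) else 0 := by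
    split_ifs with h
    · rw [Finset.sum_eq_single (j - l)]
      · rw [if_pos (by omega)]
      · intro i _ hi
        rw [if_neg (by omega)]
      · intro hi
        simp only [Finset.mem_Icc] at hi
        omega
    · refine Finset.sum_eq_zero fun i hi => ?_
      simp only [Finset.mem_Icc] at hi
      rw [if_neg (by omega)]
  have h0 := key (fun i => 2 * a (.inl (i, 0)) + a (.inl (i, 1)) + a (.inl (i, 2)) +
    a (.inl (i, 3))) 0
  have h1 := key (fun i => a (.inl (i, 1)) - a (.inl (i, 2)) - 2 * a (.inl (i, 3))) 1
  have h2 := key (fun i => a (.inl (i, 3))) 2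
  simp only [zero_add, hj, if_true, Nat.sub_zero, Nat.reduceAdd] at h0 h1 h2
  rw [coord_sum, sum_genIdx, ← h0, ← h1, ← h2, ← Finset.sum_add_distrib, ← Finset.sum_add_distrib,
    add_sub_assoc]
  congr 1
  · refine Finset.sum_congr rfl fun i _ => ?_
    simp only [genVec, coord_zsmul, coord_add, coord_sub, coord_nsmul, coord_stdVec hj hjn, add_zero]
    split_ifs <;> push_cast <;> ring
  · simp only [genVec, coord_zsmul, coord_sub, coord_nsmul, coord_stdVec hj hjn,
      eq_comm (b := j)]
    split_ifs <;> push_cast <;> ring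

/-- The weight bound for coefficient sequences: `c i`, `p i`, `m i`, `d i` are the multiplicities of
`2e_i`, `e_i + e_{i+1}`, `e_i - e_{i+1}`, `e_i - 2e_{i+1} + e_{i+2}`, and `x` is that of
`2e_1 - 2e_2`. -/
theorem add_le_abs_add_sum_abs (N : ℤ) (k : ℕ) (c p m d : ℕ → ℤ) (x : ℤ)
    (h1 : 2 * c 1 + p 1 + m 1 + d 1 + 2 * x = 2 * N + 1)
    (h2 : 2 ≤ k → 2 * c 2 + p 2 + m 2 + d 2 + (p 1 - m 1 - 2 * d 1) - 2 * x = 0)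
    (h3 : ∀ j, j + 3 ≤ k → 2 * c (j + 3) + p (j + 3) + m (j + 3) + d (j + 3) +
      (p (j + 2) - m (j + 2) - 2 * d (j + 2)) + d (j + 1) = 0) (j : ℕ) (hj : j + 1 ≤ k) :
    N + (j + 1 : ℕ) ≤
      |x| + ∑ i ∈ Finset.range (j + 1), (|c (i + 1)| + |p (i + 1)| + |m (i + 1)| + |d (i + 1)|) := by
  have hpar : ∀ j, j + 2 ≤ k → (p (j + 2) + m (j + 2) + d (j + 2) + d (j + 1)) % 2 = 1 := by
    intro j
    induction j with
    | zero =>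
      intro h
      have := h2 h
      simp only [zero_add]
      omega
    | succ j ih =>
      intro h
      have := ih (by omega)
      have := h3 j (by omega)
      simp only [add_assoc, Nat.reduceAdd] at *
      omega
  have bnd (f : ℕ → ℤ) (i : ℕ) : f i ≤ |f i| ∧ -f i ≤ |f i| := ⟨le_abs_self _, neg_le_abs _⟩
  have hx : x ≤ |x| ∧ -x ≤ |x| := ⟨le_abs_self _, neg_le_abs _⟩
  induction j using Nat.strong_induction_on with
  | _ j ih =>
    match j with
    | 0 =>
      simp only [zero_add, Finset.sum_range_one]
      have := bnd c 1; have := bnd p 1; have := bnd m 1; have := bnd d 1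
      omega
    | 1 =>
      have := h2 hj
      have i0 := ih 0 (by omega) (by omega)
      simp only [Finset.sum_range_succ, Finset.sum_range_zero, zero_add, Nat.reduceAdd] at *
      have := bnd c 1; have := bnd p 1; have := bnd m 1; have := bnd d 1
      have := bnd c 2; have := bnd p 2; have := bnd m 2; have := bnd d 2
      by_cases hw : 1 ≤ |c 2| + |p 2| + |m 2| + |d 2|
      · omega
      · obtain ⟨_, _, _, _⟩ : c 2 = 0 ∧ p 2 = 0 ∧ m 2 = 0 ∧ d 2 = 0 := by omega
        by_contra hlt
        have : 1 ≤ |d 1| := by omega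
        obtain ⟨_, _⟩ : p 1 = 0 ∧ m 1 = 0 := by omega
        omega
    | 2 =>
      have e3 := h3 0 hj
      have q := hpar 1 hj
      have i0 := ih 0 (by omega) (by omega)
      have i1 := ih 1 (by omega) (by omega)
      simp only [Finset.sum_range_succ, Finset.sum_range_zero, zero_add, Nat.reduceAdd] at *
      have := bnd c 1; have := bnd p 1; have := bnd m 1; have := bnd d 1
      have := bnd c 2; have := bnd p 2; have := bnd m 2; have := bnd d 2
      have := bnd c 3; have := bnd p 3; have := bnd m 3; have := bnd d 3
      omega
    | j + 3 =>
      have e := h3 (j + 1) hj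
      have q := hpar (j + 2) hj
      have i0 := ih j (by omega) (by omega)
      have i1 := ih (j + 1) (by omega) (by omega)
      have i2 := ih (j + 2) (by omega) (by omega)
      simp only [add_assoc, Nat.reduceAdd] at e q i0 i1 i2 ⊢
      rw [Finset.sum_range_succ _ (j + 3)]
      rw [Finset.sum_range_succ _ (j + 2)] at i2 ⊢
      rw [Finset.sum_range_succ _ (j + 1)] at i1 i2 ⊢
      simp only [add_assoc, Nat.reduceAdd] at i0 i1 i2 ⊢
      have := bnd c (j + 2); have := bnd p (j + 2); have := bnd m (j + 2); have := bnd d (j + 2)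
      have := bnd c (j + 3); have := bnd p (j + 3); have := bnd m (j + 3); have := bnd d (j + 3)
      have := bnd c (j + 4); have := bnd p (j + 4); have := bnd m (j + 4); have := bnd d (j + 4)
      push_cast at *
      omega


/-- Let `n ≥ 1` and `1 ≤ k ≤ n`. If `φ : B → ℤ` satisfies `S(φ)(1) = 2n+1` and
`S(φ)(i) = 0` for every `2 ≤ i ≤ k` (no condition on coordinates of index `> k`), then
`Σ_{v ∈ B} |φ(v)| ≥ n+k`. -/
theorem stmt_7 (n k : ℕ) (hn : 1 ≤ n) (hk1 : 1 ≤ k) (hkn : k ≤ n)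
    (φ : (Fin n → ℤ) → ℤ)
    (h1 : coord (Ssum φ) 1 = 2 * (n : ℤ) + 1)
    (h0 : ∀ i : ℕ, 2 ≤ i → i ≤ k → coord (Ssum φ) i = 0) :
    (n : ℤ) + (k : ℤ) ≤ absSum φ := by
  obtain ⟨a, hS, hA⟩ := exists_lift_sum_image (genIdx n) (genVec n) φ
  rw [image_genVec] at hS hA
  have hcoord {j : ℕ} (hj : 1 ≤ j) (hjn : j ≤ n) := coord_sum_genVec hj hjn a
  simp only [hS] at hcoord
  change ∀ {j : ℕ}, 1 ≤ j → j ≤ n → coord (Ssum φ) j = _ at hcoord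
  have key := add_le_abs_add_sum_abs n k (fun i => a (.inl (i, 0))) (fun i => a (.inl (i, 1)))
    (fun i => a (.inl (i, 2))) (fun i => a (.inl (i, 3))) (a (.inr ()))
    (by simpa [h1, eq_comm] using hcoord le_rfl hn)
    (fun h => by simpa [h0 2 le_rfl h, eq_comm] using hcoord one_le_two (h.trans hkn))
    (fun j hj => by
      simpa [h0 (j + 3) (by omega) hj, eq_comm] using hcoord (j := j + 3) (by omega) (by omega))
    (k - 1) (by omega)
  rw [Nat.sub_add_cancel hk1] at key
  rw [absSum, ← hA, sum_genIdx, add_comm (Finset.sum _ _)]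
  refine key.trans (add_le_add_right ?_ _)
  rw [Finset.range_eq_Ico, Finset.sum_Ico_add' (fun i => |a (.inl (i, 0))| + |a (.inl (i, 1))| +
    |a (.inl (i, 2))| + |a (.inl (i, 3))|) 0 k 1]
  refine Finset.sum_le_sum_of_subset_of_nonneg (fun i hi => ?_) fun i _ _ => by positivity
  simp only [Finset.mem_Ico, Finset.mem_Icc] at hi ⊢
  omega
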